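/- arXiv:2309.02876 — 4 statements merged into one kernel-verified Lean document; each statement's English description precedes it below -/
import Mathlib

section
/- For every finite tree of cycles (cactus) K, the VC-dimension of the family B(K) of balls of K is at most 3; i.e., no 4-element set of vertices of K is shattered by B(K). -/
open SimpleGraph

/-- A tree of cycles (cactus): a finite connected graph in which every edge belongs to
at most one cycle, formalized as: any two cycles sharing an edge have the same edge set. -/
def IsCactus {V : Type*} [DecidableEq V] (G : SimpleGraph V) : Prop :=
  G.Connected ∧ ∀ (u v : V) (c₁ : G.Walk u u) (c₂ : G.Walk v v),
    c₁.IsCycle → c₂.IsCycle → ∀ e ∈ c₁.edges, e ∈ c₂.edges →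
      c₁.edges.toFinset = c₂.edges.toFinset

/-- The ball of radius `r` centered at `x` in the graph `G`. -/
def gball {V : Type*} (G : SimpleGraph V) (x : V) (r : ℕ) : Set V :=
  {v | G.dist x v ≤ r}

/-- A set of vertices is walk-connected if any two of its vertices are joined by a walk
staying inside it. -/
def WalkConnected {V : Type*} (G : SimpleGraph V) (A : Set V) : Prop :=
  ∀ x ∈ A, ∀ y ∈ A, ∃ p : G.Walk x y, ∀ z ∈ p.support, z ∈ A

section

variable {V : Type*} {G : SimpleGraph V}

lemma WalkConnected.support {x y : V} (p : G.Walk x y) :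
    WalkConnected G {z | z ∈ p.support} := by
  classical
  have key : ∀ z ∈ p.support, ∃ q : G.Walk x z, ∀ w ∈ q.support, w ∈ p.support :=
    fun z hz => ⟨p.takeUntil z hz, fun w hw => p.support_takeUntil_subset_support hz hw⟩
  intro u hu v hv
  obtain ⟨q, hq⟩ := key u hu
  obtain ⟨r, hr⟩ := key v hv
  refine ⟨q.reverse.append r, fun z hz => ?_⟩
  rw [Walk.mem_support_append_iff, Walk.support_reverse, List.mem_reverse] at hz
  exact hz.elim (hq z) (hr z)

lemma WalkConnected.insert_of_adj {A : Set V} (hA : WalkConnected G A) {x y : V}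
    (hx : x ∈ A) (hxy : G.Adj x y) : WalkConnected G (insert y A) := by
  have key : ∀ z ∈ insert y A, ∃ q : G.Walk x z, ∀ w ∈ q.support, w ∈ insert y A := by
    rintro z (rfl | hz)
    · exact ⟨hxy.toWalk, by simp [hx]⟩
    · obtain ⟨q, hq⟩ := hA x hx z hz
      exact ⟨q, fun w hw => Or.inr (hq w hw)⟩
  intro u hu v hv
  obtain ⟨q, hq⟩ := key u hu
  obtain ⟨r, hr⟩ := key v hv
  refine ⟨q.reverse.append r, fun z hz => ?_⟩
  rw [Walk.mem_support_append_iff, Walk.support_reverse, List.mem_reverse] at hz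
  exact hz.elim (hq z) (hr z)

lemma exists_adj_of_walk {x y : V} (p : G.Walk x y) (U : Set V) (hx : x ∈ U) (hy : y ∉ U) :
    ∃ u v, G.Adj u v ∧ u ∈ p.support ∧ v ∈ p.support ∧ u ∈ U ∧ v ∉ U := by
  obtain ⟨d, hd, h₁, h₂⟩ := p.exists_boundary_dart U hx hy
  exact ⟨d.fst, d.snd, d.adj, p.dart_fst_mem_support_of_mem_darts hd,
    p.dart_snd_mem_support_of_mem_darts hd, h₁, h₂⟩

lemma WalkConnected.exists_adj {A : Set V} (hA : WalkConnected G A) {x y : V} (hx : x ∈ A)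
    (hy : y ∈ A) (U : Set V) (hxU : x ∈ U) (hyU : y ∉ U) :
    ∃ u v, G.Adj u v ∧ u ∈ A ∧ v ∈ A ∧ u ∈ U ∧ v ∉ U := by
  obtain ⟨p, hp⟩ := hA x hx y hy
  obtain ⟨u, v, h, hu, hv, huU, hvU⟩ := exists_adj_of_walk p U hxU hyU
  exact ⟨u, v, h, hp u hu, hp v hv, huU, hvU⟩

/-- In a finite connected graph, two disjoint connected vertex sets (the first one nonempty)
can be enlarged to complementary connected sets. -/
lemma exists_connected_partition [Finite V] (hG : G.Connected) {A B : Set V}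
    (hA : WalkConnected G A) (hB : WalkConnected G B) (hne : A.Nonempty) (hAB : Disjoint A B) :
    ∃ C : Set V, A ⊆ C ∧ B ⊆ Cᶜ ∧ WalkConnected G C ∧ WalkConnected G Cᶜ := by
  obtain ⟨C, hAC, hC⟩ := (Set.toFinite
    {C : Set V | WalkConnected G C ∧ Disjoint C B}).exists_le_maximal ⟨hA, hAB⟩
  obtain ⟨D, hBD, hD⟩ := (Set.toFinite
    {D : Set V | WalkConnected G D ∧ Disjoint C D}).exists_le_maximal ⟨hB, hC.prop.2⟩
  have hCD : C ∪ D = Set.univ := by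
    by_contra hne'
    obtain ⟨y, hy⟩ := (Set.ne_univ_iff_exists_notMem _).1 hne'
    obtain ⟨x, hx⟩ := hne
    obtain ⟨p⟩ := hG.preconnected x y
    obtain ⟨u, v, huv, -, -, hu, hv⟩ := exists_adj_of_walk p (C ∪ D) (Or.inl (hAC hx)) hy
    have hvC : v ∉ C := fun h => hv (Or.inl h)
    have hvD : v ∉ D := fun h => hv (Or.inr h)
    rcases hu with hu | hu
    · refine hvC (hC.le_of_ge ⟨hC.prop.1.insert_of_adj hu huv, ?_⟩
        (Set.subset_insert v C) (Set.mem_insert v C))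
      exact Set.disjoint_insert_left.2 ⟨fun h => hvD (hBD h), hC.prop.2⟩
    · refine hvD (hD.le_of_ge ⟨hD.prop.1.insert_of_adj hu huv, ?_⟩
        (Set.subset_insert v D) (Set.mem_insert v D))
      exact Set.disjoint_insert_right.2 ⟨hvC, hD.prop.2⟩
  have hDC : D = Cᶜ := ((isCompl_iff.2 ⟨hD.prop.2, codisjoint_iff.2 hCD⟩).compl_eq).symm
  exact ⟨C, hAC, hDC ▸ hBD, hC.prop.1, hDC ▸ hD.prop.1⟩

/-- Two distinct edges crossing a partition into connected sets lie on a cycle containing no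
other crossing edge. -/
lemma exists_isCycle_of_crossing {A : Set V} (hA : WalkConnected G A)
    (hA' : WalkConnected G Aᶜ) {u v w z : V} (huv : G.Adj u v) (hwz : G.Adj w z)
    (hu : u ∈ A) (hv : v ∉ A) (hw : w ∈ A) (hz : z ∉ A) (hne : (u, v) ≠ (w, z)) :
    ∃ c : G.Walk u u, c.IsCycle ∧ s(u, v) ∈ c.edges ∧ s(w, z) ∈ c.edges ∧
      ∀ x ∈ A, ∀ y ∉ A, s(x, y) ∈ c.edges → (x, y) = (u, v) ∨ (x, y) = (w, z) := by
  classical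
  obtain ⟨p₀, hp₀⟩ := hA w hw u hu
  obtain ⟨q₀, hq₀⟩ := hA' v hv z hz
  obtain ⟨p, hp, hpA⟩ : ∃ p : G.Walk w u, p.IsPath ∧ ∀ x ∈ p.support, x ∈ A :=
    ⟨p₀.bypass, p₀.bypass_isPath, fun x hx => hp₀ x (p₀.support_bypass_subset_support hx)⟩
  obtain ⟨q, hq, hqA⟩ : ∃ q : G.Walk v z, q.IsPath ∧ ∀ x ∈ q.support, x ∉ A :=
    ⟨q₀.bypass, q₀.bypass_isPath, fun x hx => hq₀ x (q₀.support_bypass_subset_support hx)⟩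
  have hedge : ∀ x ∈ A, ∀ y ∉ A,
      s(x, y) ∈ (q.append (Walk.cons hwz.symm p)).edges → (x, y) = (w, z) := by
    intro x hx y hy h
    rw [Walk.edges_append, List.mem_append, Walk.edges_cons, List.mem_cons] at h
    rcases h with h | h | h
    · exact absurd hx (hqA x (q.fst_mem_support_of_mem_edges h))
    · rcases Sym2.eq_iff.1 h with ⟨rfl, rfl⟩ | ⟨rfl, rfl⟩
      · exact absurd hx hz
      · rfl
    · exact absurd (hpA y (p.snd_mem_support_of_mem_edges h)) hy
  refine ⟨Walk.cons huv (q.append (Walk.cons hwz.symm p)), ?_, by simp, by simp [Sym2.eq_swap], ?_⟩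
  · rw [Walk.cons_isCycle_iff]
    refine ⟨?_, fun h => hne (hedge u hu v hv h)⟩
    rw [Walk.isPath_def, Walk.support_append, Walk.support_cons, List.tail_cons]
    exact List.Nodup.append hq.support_nodup hp.support_nodup
      fun x hx hx' => hqA x hx (hpA x hx')
  · intro x hx y hy h
    rw [Walk.edges_cons, List.mem_cons] at h
    rcases h with h | h
    · rcases Sym2.eq_iff.1 h with ⟨rfl, rfl⟩ | ⟨rfl, rfl⟩
      · exact Or.inl rfl
      · exact absurd hx hv
    · exact Or.inr (hedge x hx y hy h)

/-- In a cactus, at most two edges cross a partition into two connected sets. -/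
lemma IsCactus.eq_or_eq_of_crossing [DecidableEq V] (hG : IsCactus G) {A : Set V}
    (hA : WalkConnected G A) (hA' : WalkConnected G Aᶜ) {u v w z x y : V}
    (huv : G.Adj u v) (hwz : G.Adj w z) (hxy : G.Adj x y) (hu : u ∈ A) (hv : v ∉ A)
    (hw : w ∈ A) (hz : z ∉ A) (hx : x ∈ A) (hy : y ∉ A) (hne : (u, v) ≠ (w, z)) :
    (x, y) = (u, v) ∨ (x, y) = (w, z) := by
  by_contra! h
  obtain ⟨c₁, hc₁, h₁, -, h₁'⟩ := exists_isCycle_of_crossing hA hA' huv hwz hu hv hw hz hne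
  obtain ⟨c₂, hc₂, h₂, h₂', -⟩ :=
    exists_isCycle_of_crossing hA hA' huv hxy hu hv hx hy h.1.symm
  have := hG.2 u u c₁ c₂ hc₁ hc₂ _ h₁ h₂
  rw [← List.mem_toFinset, ← this, List.mem_toFinset] at h₂'
  exact (h₁' x hx y hy h₂').elim h.1 h.2

/-- In a cactus, no four vertices can be joined in pairs by disjoint walks in all three
possible ways. -/
lemma IsCactus.false_of_disjoint_walks [Finite V] [DecidableEq V] (hG : IsCactus G)
    {a b c d : V} (ab : G.Walk a b) (cd : G.Walk c d) (ac : G.Walk a c) (bd : G.Walk b d)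
    (ad : G.Walk a d) (bc : G.Walk b c) (h₁ : ab.support.Disjoint cd.support)
    (h₂ : ac.support.Disjoint bd.support) (h₃ : ad.support.Disjoint bc.support) : False := by
  obtain ⟨A, habA, hcdA, hA, hA'⟩ := exists_connected_partition hG.1
    (WalkConnected.support ab) (WalkConnected.support cd) ⟨a, ab.start_mem_support⟩
    (Set.disjoint_left.2 fun _ h h' => h₁ h h')
  obtain ⟨B, hacB, hbdB, hB, hB'⟩ := exists_connected_partition hG.1
    (WalkConnected.support ac) (WalkConnected.support bd) ⟨a, ac.start_mem_support⟩
    (Set.disjoint_left.2 fun _ h h' => h₂ h h')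
  have haA : a ∈ A := habA ab.start_mem_support
  have hbA : b ∈ A := habA ab.end_mem_support
  have hcA : c ∉ A := hcdA cd.start_mem_support
  have hdA : d ∉ A := hcdA cd.end_mem_support
  have haB : a ∈ B := hacB ac.start_mem_support
  have hcB : c ∈ B := hacB ac.end_mem_support
  have hbB : b ∉ B := hbdB bd.start_mem_support
  have hdB : d ∉ B := hbdB bd.end_mem_support
  obtain ⟨u₁, v₁, e₁, hu₁A, hv₁A, hu₁B, hv₁B⟩ := hA.exists_adj haA hbA B haB hbB
  obtain ⟨u₂, v₂, e₂, hu₂A, hv₂A, hu₂B, hv₂B⟩ := hA'.exists_adj hcA hdA B hcB hdB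
  obtain ⟨u₃, v₃, e₃, hu₃B, hv₃B, hu₃A, hv₃A⟩ := hB.exists_adj haB hcB A haA hcA
  obtain ⟨u₄, v₄, e₄, hu₄B, hv₄B, hu₄A, hv₄A⟩ := hB'.exists_adj hbB hdB A hbA hdA
  have crossB : ∀ x y, G.Adj x y → x ∈ B → y ∉ B → (x = u₁ ∧ y = v₁) ∨ (x = u₂ ∧ y = v₂) := by
    intro x y h hx hy
    simpa using hG.eq_or_eq_of_crossing hB hB' e₁ e₂ h hu₁B hv₁B hu₂B hv₂B hx hy
      fun h => hu₂A ((Prod.mk.inj h).1 ▸ hu₁A)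
  have crossA : ∀ x y, G.Adj x y → x ∈ A → y ∉ A → (x = u₃ ∧ y = v₃) ∨ (x = u₄ ∧ y = v₄) := by
    intro x y h hx hy
    simpa using hG.eq_or_eq_of_crossing hA hA' e₃ e₄ h hu₃A hv₃A hu₄A hv₄A hx hy
      fun h => hu₄B ((Prod.mk.inj h).1 ▸ hu₃B)
  simp only [Set.mem_compl_iff] at hu₂A hv₂A hu₄B hv₄B
  clear habA hcdA hacB hbdB
  have adA : (u₃ ∈ ad.support) ∨ (u₄ ∈ ad.support) := by
    obtain ⟨x, y, h, hx, hy, hxU, hyU⟩ := exists_adj_of_walk ad A haA hdA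
    have hxyA := crossA x y h
    clear crossA crossB
    grind
  have adB : (u₁ ∈ ad.support) ∨ (u₂ ∈ ad.support) := by
    obtain ⟨x, y, h, hx, hy, hxU, hyU⟩ := exists_adj_of_walk ad B haB hdB
    have hxyB := crossB x y h
    clear crossA crossB
    grind
  have bcA : (u₃ ∈ bc.support) ∨ (u₄ ∈ bc.support) := by
    obtain ⟨x, y, h, hx, hy, hxU, hyU⟩ := exists_adj_of_walk bc A hbA hcA
    have hxyA := crossA x y h
    clear crossA crossB
    grind
  have bcB : (u₁ ∈ bc.support) ∨ (u₂ ∈ bc.support) := by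
    obtain ⟨x, y, h, hx, hy, hxU, hyU⟩ := exists_adj_of_walk bc Bᶜ hbB (by simpa using hcB)
    have hxyB := crossB y x h.symm
    clear crossA crossB
    grind
  have leave_a : (u₁ ∈ ad.support) ∨ (u₃ ∈ ad.support) := by
    obtain ⟨x, y, h, hx, hy, hxU, hyU⟩ :=
      exists_adj_of_walk ad (A ∩ B) ⟨haA, haB⟩ fun h => hdA h.1
    have hxyA := crossA x y h
    have hxyB := crossB x y h
    clear crossA crossB
    grind
  have enter_d : (u₂ ∈ ad.support) ∨ (u₄ ∈ ad.support) := by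
    obtain ⟨x, y, h, hx, hy, hxU, hyU⟩ :=
      exists_adj_of_walk ad (A ∪ B) (Or.inl haA) fun h => h.elim hdA hdB
    have hxyA := crossA x y h
    have hxyB := crossB x y h
    clear crossA crossB
    grind
  have leave_b : (u₁ ∈ bc.support) ∨ (u₄ ∈ bc.support) := by
    obtain ⟨x, y, h, hx, hy, hxU, hyU⟩ :=
      exists_adj_of_walk bc (A \ B) ⟨hbA, hbB⟩ fun h => hcA h.1
    have hxyA := crossA x y h
    have hxyB := crossB y x h.symm
    clear crossA crossB
    grind
  have enter_c : (u₂ ∈ bc.support) ∨ (u₃ ∈ bc.support) := by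
    obtain ⟨x, y, h, hx, hy, hxU, hyU⟩ :=
      exists_adj_of_walk bc (B \ A)ᶜ (fun h => hbB h.1) fun h => h ⟨hcB, hcA⟩
    obtain ⟨hyB, hyA⟩ := not_not.1 hyU
    have hxyA := crossA x y h
    have hxyB := crossB y x h.symm
    clear crossA crossB
    grind
  have disj : ∀ x, x ∈ ad.support → x ∉ bc.support := fun x h h' => h₃ h h'
  have := disj u₁
  have := disj u₂
  have := disj u₃
  have := disj u₄
  clear crossA crossB disj
  grind only

/-- Along a geodesic to `a`, strict proximity to `a` rather than to `c` persists. -/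
lemma SimpleGraph.Connected.exists_walk_dist_lt (hG : G.Connected) (x a : V) :
    ∃ p : G.Walk x a, ∀ z ∈ p.support, ∀ c, G.dist x a < G.dist x c →
      G.dist z a < G.dist z c := by
  classical
  obtain ⟨p, hp⟩ := hG.exists_walk_length_eq_dist x a
  refine ⟨p, fun z hz c hc => ?_⟩
  have hlen : (p.takeUntil z hz).length + (p.dropUntil z hz).length = p.length := by
    rw [← Walk.length_append, p.take_spec hz]
  have h₁ := dist_le (p.takeUntil z hz)
  have h₂ := dist_le (p.dropUntil z hz)
  have h₃ := hG.dist_triangle (u := x) (v := z) (w := c)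
  omega

/-- If a ball contains `a`, `b` but not `c`, `d`, then `a` and `b` are joined by a walk each of
whose vertices is closer to `a` or `b` than to both `c` and `d`. -/
lemma exists_walk_of_gball (hG : G.Connected) {a b c d x : V} {r : ℕ}
    (ha : a ∈ gball G x r) (hb : b ∈ gball G x r) (hc : c ∉ gball G x r)
    (hd : d ∉ gball G x r) :
    ∃ p : G.Walk a b, ∀ z ∈ p.support,
      min (G.dist z a) (G.dist z b) < min (G.dist z c) (G.dist z d) := by
  simp only [gball, Set.mem_ofPred_eq, not_le] at ha hb hc hd
  obtain ⟨p, hp⟩ := hG.exists_walk_dist_lt x a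
  obtain ⟨q, hq⟩ := hG.exists_walk_dist_lt x b
  refine ⟨p.reverse.append q, fun z hz => ?_⟩
  rw [Walk.mem_support_append_iff, Walk.support_reverse, List.mem_reverse] at hz
  rcases hz with hz | hz
  · have := hp z hz c (by omega)
    have := hp z hz d (by omega)
    omega
  · have := hq z hz c (by omega)
    have := hq z hz d (by omega)
    omega

end

/-- For every finite tree of cycles `K`, the VC-dimension of the family of balls of `K`
is at most `3`: every set of vertices shattered by the balls has at most `3` elements
(in particular, no `4`-element set is shattered). -/
theorem stmt16 {V : Type*} [Fintype V] [DecidableEq V] (G : SimpleGraph V)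
    (hG : IsCactus G) (S : Finset V)
    (hshatter : ∀ A : Finset V, A ⊆ S →
      ∃ (x : V) (r : ℕ), gball G x r ∩ (↑S : Set V) = (↑A : Set V)) :
    S.card ≤ 3 := by
  by_contra! hcard
  obtain ⟨T, hTS, hT⟩ := Finset.exists_subset_card_eq (Nat.succ_le_of_lt hcard)
  obtain ⟨a, b, c, d, hab, hac, had, hbc, hbd, hcd, rfl⟩ := Finset.card_eq_four.1 hT
  simp only [Finset.insert_subset_iff, Finset.singleton_subset_iff] at hTS
  obtain ⟨ha, hb, hc, hd⟩ := hTS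
  have key : ∀ i ∈ S, ∀ j ∈ S, ∀ k ∈ S, ∀ l ∈ S, k ≠ i → k ≠ j → l ≠ i → l ≠ j →
      ∃ p : G.Walk i j, ∀ z ∈ p.support,
        min (G.dist z i) (G.dist z j) < min (G.dist z k) (G.dist z l) := by
    intro i hi j hj k hk l hl hki hkj hli hlj
    obtain ⟨x, r, h⟩ := hshatter {i, j} (by simp [Finset.insert_subset_iff, hi, hj])
    have hmem : ∀ y ∈ S, y ∈ gball G x r ↔ y = i ∨ y = j := by
      intro y hy
      have := Set.ext_iff.1 h y
      simpa [hy] using this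
    exact exists_walk_of_gball hG.1 ((hmem i hi).2 (Or.inl rfl)) ((hmem j hj).2 (Or.inr rfl))
      (by simp [hmem k hk, hki, hkj]) (by simp [hmem l hl, hli, hlj])
  obtain ⟨ab, h_ab⟩ := key a ha b hb c hc d hd hac.symm hbc.symm had.symm hbd.symm
  obtain ⟨cd, h_cd⟩ := key c hc d hd a ha b hb hac had hbc hbd
  obtain ⟨ac, h_ac⟩ := key a ha c hc b hb d hd hab.symm hbc had.symm hcd.symm
  obtain ⟨bd, h_bd⟩ := key b hb d hd a ha c hc hab had hbc.symm hcd
  obtain ⟨ad, h_ad⟩ := key a ha d hd b hb c hc hab.symm hbd hac.symm hcd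
  obtain ⟨bc, h_bc⟩ := key b hb c hc a ha d hd hab hac hbd.symm hcd.symm
  exact hG.false_of_disjoint_walks ab cd ac bd ad bc
    (fun z h h' => (h_ab z h).not_gt (h_cd z h'))
    (fun z h h' => (h_ac z h).not_gt (h_bd z h'))
    (fun z h h' => (h_ad z h).not_gt (h_bc z h'))
end

section
/- Let δ ≥ 0 be a real number and let G be a finite connected δ-hyperbolic graph. Let B_{r₁}(x) and B_{r₂}(y) be balls of G, let {u,v} be a diametral pair of B_{r₂}(y), and suppose there exists z ∈ B_{r₂}(y) with d(x,z) > r₁ + 2δ. Then u ∉ B_{r₁}(x) or v ∉ B_{r₁}(x). -/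
open SimpleGraph

/-- Let `δ ≥ 0` and let `G` be a finite connected `δ`-hyperbolic graph. Let `{u, v}` be
a diametral pair of a ball `B_{r₂}(y)` and suppose some `z ∈ B_{r₂}(y)` satisfies
`d(x,z) > r₁ + 2δ`. Then `u ∉ B_{r₁}(x)` or `v ∉ B_{r₁}(x)`. -/
theorem stmt17 {V : Type*} [Fintype V] (G : SimpleGraph V)
    (hconn : G.Connected) (δ : ℝ) (hδ : 0 ≤ δ)
    (hhyp : ∀ a b c d : V,
      (G.dist a b : ℝ) + (G.dist c d : ℝ) ≤
        max ((G.dist a c : ℝ) + (G.dist b d : ℝ))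
            ((G.dist a d : ℝ) + (G.dist b c : ℝ)) + 2 * δ)
    (x y u v z : V) (r₁ r₂ : ℕ)
    (hu : u ∈ gball G y r₂) (hv : v ∈ gball G y r₂)
    (hdiam : ∀ a ∈ gball G y r₂, ∀ b ∈ gball G y r₂, G.dist a b ≤ G.dist u v)
    (hz : z ∈ gball G y r₂)
    (hzfar : (r₁ : ℝ) + 2 * δ < (G.dist x z : ℝ)) :
    u ∉ gball G x r₁ ∨ v ∉ gball G x r₁ := by
  by_contra! h
  obtain ⟨hxu, hxv⟩ := h
  have hxu' : (G.dist x u : ℝ) ≤ r₁ := by exact_mod_cast hxu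
  have hxv' : (G.dist x v : ℝ) ≤ r₁ := by exact_mod_cast hxv
  have hzu : (G.dist z u : ℝ) ≤ G.dist u v := by exact_mod_cast hdiam z hz u hu
  have hzv : (G.dist z v : ℝ) ≤ G.dist u v := by exact_mod_cast hdiam z hz v hv
  have hmax : max ((G.dist x u : ℝ) + G.dist z v) ((G.dist x v : ℝ) + G.dist z u) ≤
      r₁ + G.dist u v := max_le (by linarith) (by linarith)
  linarith [hhyp x z u v]
end

section
/- Let δ ≥ 0 be a real number and let G be a finite connected δ-hyperbolic graph. Define a positive teaching map T on balls of G by: T(x,0) = {x}, and for r ≥ 1, T(x,r) = {u,v} for some diametral pair u,v of B_r(x). Then T is a 2δ-approximate positive non-clashing teaching map of size 2 for B(G): for every two 2δ-distinct balls B_{r₁}(x) and B_{r₂}(y), there exists q ∈ T(x,r₁) ∪ T(y,r₂) belonging to exactly one of B_{r₁}(x) and B_{r₂}(y). -/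
open SimpleGraph

/-- A ball of a connected graph has a diametral pair equal to its teaching set, radius zero
included. -/
lemma exists_diametral_pair_of_teaching_map {V : Type*} [DecidableEq V] {G : SimpleGraph V}
    (hconn : G.Connected) {T : V → ℕ → Finset V} (hT0 : ∀ x : V, T x 0 = {x})
    (hTr : ∀ (x : V) (r : ℕ), 1 ≤ r → ∃ u v : V,
      u ∈ gball G x r ∧ v ∈ gball G x r ∧
      (∀ a ∈ gball G x r, ∀ b ∈ gball G x r, G.dist a b ≤ G.dist u v) ∧
      T x r = {u, v}) (x : V) (r : ℕ) :
    ∃ u v : V, u ∈ gball G x r ∧ v ∈ gball G x r ∧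
      (∀ a ∈ gball G x r, ∀ b ∈ gball G x r, G.dist a b ≤ G.dist u v) ∧
      T x r = {u, v} := by
  rcases Nat.eq_zero_or_pos r with rfl | hr
  · have eq_center : ∀ a ∈ gball G x 0, x = a := fun a ha =>
      hconn.dist_eq_zero_iff.mp (Nat.le_zero.mp ha)
    refine ⟨x, x, by simp [gball], by simp [gball], fun a ha b hb => ?_, by simp [hT0]⟩
    rw [← eq_center a ha, ← eq_center b hb]
  · exact hTr x r hr

/-- In a hyperbolic graph, a ball around `y` containing a diametral pair of a set `S` contains
all of `S` up to an increase of its radius by `2 * δ`. -/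
lemma dist_le_add_of_diametral_pair {V : Type*} {G : SimpleGraph V} {δ : ℝ}
    (hhyp : ∀ a b c d : V,
      (G.dist a b : ℝ) + (G.dist c d : ℝ) ≤
        max ((G.dist a c : ℝ) + (G.dist b d : ℝ))
            ((G.dist a d : ℝ) + (G.dist b c : ℝ)) + 2 * δ)
    {S : Set V} {u v y : V} {r : ℕ} (hu : u ∈ S) (hv : v ∈ S)
    (hmax : ∀ a ∈ S, ∀ b ∈ S, G.dist a b ≤ G.dist u v)
    (hyu : u ∈ gball G y r) (hyv : v ∈ gball G y r) :
    S ⊆ {w : V | (G.dist y w : ℝ) ≤ (r : ℝ) + 2 * δ} := by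
  intro w hw
  have hwu : (G.dist w u : ℝ) ≤ G.dist u v := by exact_mod_cast hmax w hw u hu
  have hwv : (G.dist w v : ℝ) ≤ G.dist u v := by exact_mod_cast hmax w hw v hv
  have hru : (G.dist y u : ℝ) ≤ r := by exact_mod_cast hyu
  have hrv : (G.dist y v : ℝ) ≤ r := by exact_mod_cast hyv
  have hle : max ((G.dist y u : ℝ) + G.dist w v) ((G.dist y v : ℝ) + G.dist w u) ≤
      r + G.dist u v := max_le (by linarith) (by linarith)
  have := hhyp y w u v
  rw [Set.mem_ofPred_eq]
  linarith

/-- Let `δ ≥ 0` and let `G` be a finite connected `δ`-hyperbolic graph. The positive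
teaching map `T` with `T(x,0) = {x}` and `T(x,r)` a diametral pair of `B_r(x)` for
`r ≥ 1` is a `2δ`-approximate positive non-clashing teaching map of size `2` for
`B(G)`: each teaching set is contained in its ball and has at most `2` elements, and
for every two `2δ`-distinct balls `B_{r₁}(x)`, `B_{r₂}(y)` there is an example
`q ∈ T(x,r₁) ∪ T(y,r₂)` belonging to exactly one of the two balls. -/
theorem stmt18 {V : Type*} [Fintype V] [DecidableEq V] (G : SimpleGraph V)
    (hconn : G.Connected) (δ : ℝ) (hδ : 0 ≤ δ)
    (hhyp : ∀ a b c d : V,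
      (G.dist a b : ℝ) + (G.dist c d : ℝ) ≤
        max ((G.dist a c : ℝ) + (G.dist b d : ℝ))
            ((G.dist a d : ℝ) + (G.dist b c : ℝ)) + 2 * δ)
    (T : V → ℕ → Finset V)
    (hT0 : ∀ x : V, T x 0 = {x})
    (hTr : ∀ (x : V) (r : ℕ), 1 ≤ r → ∃ u v : V,
      u ∈ gball G x r ∧ v ∈ gball G x r ∧
      (∀ a ∈ gball G x r, ∀ b ∈ gball G x r, G.dist a b ≤ G.dist u v) ∧
      T x r = {u, v}) :
    (∀ (x : V) (r : ℕ), (↑(T x r) : Set V) ⊆ gball G x r) ∧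
    (∀ (x : V) (r : ℕ), (T x r).card ≤ 2) ∧
    (∀ (x y : V) (r₁ r₂ : ℕ),
      (¬ gball G x r₁ ⊆ {w : V | (G.dist y w : ℝ) ≤ (r₂ : ℝ) + 2 * δ} ∨
       ¬ gball G y r₂ ⊆ {w : V | (G.dist x w : ℝ) ≤ (r₁ : ℝ) + 2 * δ}) →
      ∃ q ∈ T x r₁ ∪ T y r₂, Xor' (q ∈ gball G x r₁) (q ∈ gball G y r₂)) := by
  have hT := exists_diametral_pair_of_teaching_map hconn hT0 hTr
  have hsub : ∀ (x : V) (r : ℕ), (↑(T x r) : Set V) ⊆ gball G x r := by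
    intro x r
    obtain ⟨u, v, hu, hv, -, huv⟩ := hT x r
    simp [huv, Set.insert_subset_iff, hu, hv]
  refine ⟨hsub, fun x r => ?_, fun x y r₁ r₂ hdist => ?_⟩
  · obtain ⟨u, v, -, -, -, huv⟩ := hT x r
    exact huv ▸ Finset.card_le_two
  · by_contra hno
    have hiff : ∀ q ∈ T x r₁ ∪ T y r₂, (q ∈ gball G x r₁ ↔ q ∈ gball G y r₂) :=
      fun q hq => by
        by_contra hne
        exact hno ⟨q, hq, xor_iff_not_iff _ _ |>.mpr hne⟩
    rcases hdist with h | h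
    · obtain ⟨u, v, hu, hv, hmax, huv⟩ := hT x r₁
      exact h (dist_le_add_of_diametral_pair hhyp hu hv hmax
        ((hiff u (by simp [huv])).mp hu) ((hiff v (by simp [huv])).mp hv))
    · obtain ⟨u, v, hu, hv, hmax, huv⟩ := hT y r₂
      exact h (dist_le_add_of_diametral_pair hhyp hu hv hmax
        ((hiff u (by simp [huv])).mpr hu) ((hiff v (by simp [huv])).mpr hv))
end

section
/- Let G be a finite connected simple graph with at least 3 vertices, let X ⊆ V(G) be a vertex cover of G (so V(G) \ X is an independent set), and let S ⊆ V(G) \ X be a set of at least 2^{|X|} + 2 vertices that are pairwise false twins. Let y ∈ S and let G' be the induced subgraph of G on V(G) \ {y} (which is connected). Then, for every positive integer k, B(G) admits a positive non-clashing teaching map of size at most k if and only if B(G') admits a positive non-clashing teaching map of size at most k. -/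
open SimpleGraph

/-- The family of all (distinct) balls of `G`. -/
def gballs {V : Type*} (G : SimpleGraph V) : Set (Set V) :=
  {B | ∃ (x : V) (r : ℕ), B = gball G x r}

/-- `T` is a positive non-clashing teaching map (NCTM⁺) for the family `𝒞`. -/
def IsPosNCTM {V : Type*} [DecidableEq V] (𝒞 : Set (Set V))
    (T : Set V → Finset V) : Prop :=
  (∀ C ∈ 𝒞, (↑(T C) : Set V) ⊆ C) ∧
  ∀ C ∈ 𝒞, ∀ C' ∈ 𝒞, C ≠ C' →
    ∃ q ∈ T C ∪ T C', Xor' (q ∈ C) (q ∈ C')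

theorem isPosNCTM_iff {V : Type*} [DecidableEq V] {𝒞 : Set (Set V)} {T : Set V → Finset V} :
    IsPosNCTM 𝒞 T ↔ (∀ C ∈ 𝒞, ∀ q ∈ T C, q ∈ C) ∧
      ∀ C ∈ 𝒞, ∀ C' ∈ 𝒞, C ≠ C' → (∃ q ∈ T C, q ∉ C') ∨ ∃ q ∈ T C', q ∉ C := by
  constructor
  · rintro ⟨hsub, hT⟩
    refine ⟨fun C hC q hq => hsub C hC hq, fun C hC C' hC' hne => ?_⟩
    obtain ⟨q, hq, ⟨-, hqn⟩ | ⟨-, hqn⟩⟩ := hT C hC C' hC' hne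
    · rcases Finset.mem_union.1 hq with hq | hq
      · exact .inl ⟨q, hq, hqn⟩
      · exact absurd (hsub C' hC' hq) hqn
    · rcases Finset.mem_union.1 hq with hq | hq
      · exact absurd (hsub C hC hq) hqn
      · exact .inr ⟨q, hq, hqn⟩
  · rintro ⟨hsub, hT⟩
    refine ⟨fun C hC q hq => hsub C hC q hq, fun C hC C' hC' hne => ?_⟩
    rcases hT C hC C' hC' hne with ⟨q, hq, hqn⟩ | ⟨q, hq, hqn⟩
    · exact ⟨q, Finset.mem_union_left _ hq, .inl ⟨hsub C hC q hq, hqn⟩⟩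
    · exact ⟨q, Finset.mem_union_right _ hq, .inr ⟨hsub C' hC' q hq, hqn⟩⟩

/-- The combinatorial shape of the family of balls of a graph in which `S` is a set of
false twins with common neighborhood `N`. -/
structure IsTwinFamily {V : Type*} (𝒞 : Set (Set V)) (S N : Set V) : Prop where
  cases : ∀ C ∈ 𝒞, S ⊆ C ∨ Disjoint S C ∨ ∃ s ∈ S, C = {s} ∨ C = insert s N
  singleton_mem : ∀ s ∈ S, {s} ∈ 𝒞
  insert_mem : ∀ s ∈ S, insert s N ∈ 𝒞
  disjoint : Disjoint S N

/-- The traces on `V \ {y}` of the members of `𝒞` other than `{y}` and `N ∪ {y}`. -/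
def traceFamily {V : Type*} (𝒞 : Set (Set V)) (N : Set V) (y : V) :
    Set (Set {v : V | v ≠ y}) :=
  {D | ∃ C ∈ 𝒞, C ≠ {y} ∧ C ≠ insert y N ∧ D = Subtype.val ⁻¹' C}

namespace IsTwinFamily

variable {V : Type*} {𝒞 : Set (Set V)} {S N : Set V}

theorem subset_of_mem (h : IsTwinFamily 𝒞 S N) {C : Set V} (hC : C ∈ 𝒞) {a b : V}
    (ha : a ∈ S) (hb : b ∈ S) (hab : a ≠ b) (haC : a ∈ C) (hbC : b ∈ C) : S ⊆ C := by
  have hd := Set.disjoint_left.1 h.disjoint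
  rcases h.cases C hC with h1 | h1 | ⟨s, -, rfl | rfl⟩
  · exact h1
  · exact absurd haC (Set.disjoint_left.1 h1 ha)
  · exact absurd (haC.trans hbC.symm) hab
  · rcases haC with rfl | haC
    · rcases hbC with rfl | hbC
      · exact absurd rfl hab
      · exact absurd hbC (hd hb)
    · exact absurd haC (hd ha)

theorem subset_of_ne (h : IsTwinFamily 𝒞 S N) {C : Set V} (hC : C ∈ 𝒞) {y : V} (hy : y ∈ S)
    (hyC : y ∈ C) (h1 : C ≠ {y}) (h2 : C ≠ insert y N) : S ⊆ C := by
  have hd := Set.disjoint_left.1 h.disjoint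
  rcases h.cases C hC with h3 | h3 | ⟨s, -, rfl | rfl⟩
  · exact h3
  · exact absurd hyC (Set.disjoint_left.1 h3 hy)
  · obtain rfl : y = s := hyC
    exact absurd rfl h1
  · rcases hyC with rfl | hyC
    · exact absurd rfl h2
    · exact absurd hyC (hd hy)

theorem eq_of_trace_eq (h : IsTwinFamily 𝒞 S N) {y a b : V} (hy : y ∈ S) (ha : a ∈ S)
    (hb : b ∈ S) (hab : a ≠ b) (hay : a ≠ y) (hby : b ≠ y) {C D : Set V} (hC : C ∈ 𝒞)
    (hD : D ∈ 𝒞) (hC1 : C ≠ {y}) (hC2 : C ≠ insert y N) (hD1 : D ≠ {y}) (hD2 : D ≠ insert y N)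
    (hCD : ∀ v, v ≠ y → (v ∈ C ↔ v ∈ D)) : C = D := by
  have hyCD : y ∈ C ↔ y ∈ D := by
    constructor
    · intro hyC
      have hs := h.subset_of_ne hC hy hyC hC1 hC2
      exact h.subset_of_mem hD ha hb hab ((hCD a hay).1 (hs ha)) ((hCD b hby).1 (hs hb)) hy
    · intro hyD
      have hs := h.subset_of_ne hD hy hyD hD1 hD2
      exact h.subset_of_mem hC ha hb hab ((hCD a hay).2 (hs ha)) ((hCD b hby).2 (hs hb)) hy
  ext v
  by_cases hv : v = y
  · rw [hv, hyCD]
  · exact hCD v hv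

theorem preimage_swap_mem [DecidableEq V] (h : IsTwinFamily 𝒞 S N) {a b : V} (ha : a ∈ S)
    (hb : b ∈ S) {C : Set V} (hC : C ∈ 𝒞) : Equiv.swap a b ⁻¹' C ∈ 𝒞 := by
  have hd := Set.disjoint_left.1 h.disjoint
  have hS : ∀ s ∈ S, Equiv.swap a b s ∈ S := by
    intro s hs
    rw [Equiv.swap_apply_def]
    split_ifs <;> assumption
  have hfix : ∀ D : Set V, (a ∈ D ↔ b ∈ D) → Equiv.swap a b ⁻¹' D = D := by
    intro D hD
    ext v
    rw [Set.mem_preimage, Equiv.swap_apply_def]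
    split_ifs with h1 h2
    · rw [h1, hD]
    · rw [h2, hD]
    · rfl
  have hsingle : ∀ s, Equiv.swap a b ⁻¹' {s} = {Equiv.swap a b s} := by
    intro s
    ext v
    simp [Equiv.swap_apply_eq_iff]
  rcases h.cases C hC with h1 | h1 | ⟨s, hs, rfl | rfl⟩
  · rwa [hfix C (by simp [h1 ha, h1 hb])]
  · have h2 := Set.disjoint_left.1 h1
    rwa [hfix C (by simp [h2 ha, h2 hb])]
  · rw [hsingle]
    exact h.singleton_mem _ (hS s hs)
  · rw [Set.insert_eq, Set.preimage_union, hsingle, hfix N (by simp [hd ha, hd hb]),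
      ← Set.insert_eq]
    exact h.insert_mem _ (hS s hs)

theorem swap_teaching [DecidableEq V] (h : IsTwinFamily 𝒞 S N) {a b : V} (ha : a ∈ S)
    (hb : b ∈ S) {T : Set V → Finset V} (hT : IsPosNCTM 𝒞 T) :
    IsPosNCTM 𝒞
      (fun C => (T (Equiv.swap a b ⁻¹' C)).map (Equiv.swap a b).toEmbedding) := by
  rw [isPosNCTM_iff] at hT ⊢
  obtain ⟨hsub, hT⟩ := hT
  constructor
  · intro C hC q hq
    obtain ⟨p, hp, rfl⟩ := Finset.mem_map.1 hq
    exact hsub _ (h.preimage_swap_mem ha hb hC) p hp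
  · intro C hC D hD hne
    have hne' : Equiv.swap a b ⁻¹' C ≠ Equiv.swap a b ⁻¹' D := fun he =>
      hne ((Equiv.swap a b).surjective.preimage_injective he)
    rcases hT _ (h.preimage_swap_mem ha hb hC) _ (h.preimage_swap_mem ha hb hD) hne' with
      ⟨q, hq, hqn⟩ | ⟨q, hq, hqn⟩
    · exact .inl ⟨Equiv.swap a b q, Finset.mem_map_of_mem _ hq, hqn⟩
    · exact .inr ⟨Equiv.swap a b q, Finset.mem_map_of_mem _ hq, hqn⟩

/-- A positive non-clashing teaching map of the trace family extends to the whole family. -/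
theorem exists_extend [DecidableEq V] (h : IsTwinFamily 𝒞 S N) {y a b : V} (hy : y ∈ S)
    (ha : a ∈ S) (hb : b ∈ S) (hab : a ≠ b) (hay : a ≠ y) (hby : b ≠ y) (hN : N.Nonempty)
    {k : ℕ} (hk : 0 < k)
    {T' : Set {v : V | v ≠ y} → Finset {v : V | v ≠ y}}
    (hT' : IsPosNCTM (traceFamily 𝒞 N y) T')
    (hcard : ∀ D ∈ traceFamily 𝒞 N y, (T' D).card ≤ k) :
    ∃ T : Set V → Finset V, IsPosNCTM 𝒞 T ∧ ∀ C ∈ 𝒞, (T C).card ≤ k := by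
  classical
  have hd := Set.disjoint_left.1 h.disjoint
  rw [isPosNCTM_iff] at hT'
  obtain ⟨hsub, hT'⟩ := hT'
  let U : Set V → Finset V := fun C => (T' (Subtype.val ⁻¹' C)).map (Function.Embedding.subtype _)
  have hmem : ∀ C ∈ 𝒞, C ≠ {y} → C ≠ insert y N →
      (Subtype.val ⁻¹' C : Set {v : V | v ≠ y}) ∈ traceFamily 𝒞 N y :=
    fun C hC h1 h2 => ⟨C, hC, h1, h2, rfl⟩
  have hUy : ∀ C, y ∉ U C := by
    intro C hyU
    obtain ⟨p, -, hp⟩ := Finset.mem_map.1 hyU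
    exact p.2 hp
  have hUsub : ∀ C ∈ 𝒞, C ≠ {y} → C ≠ insert y N → ∀ q ∈ U C, q ∈ C := by
    intro C hC h1 h2 q hq
    obtain ⟨p, hp, rfl⟩ := Finset.mem_map.1 hq
    exact hsub _ (hmem C hC h1 h2) p hp
  have hUcard : ∀ C ∈ 𝒞, C ≠ {y} → C ≠ insert y N → (U C).card ≤ k := by
    intro C hC h1 h2
    rw [Finset.card_map]
    exact hcard _ (hmem C hC h1 h2)
  have hU : ∀ C ∈ 𝒞, C ≠ {y} → C ≠ insert y N → ∀ D ∈ 𝒞, D ≠ {y} → D ≠ insert y N → C ≠ D →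
      (∃ q ∈ U C, q ∉ D) ∨ ∃ q ∈ U D, q ∉ C := by
    intro C hC hC1 hC2 D hD hD1 hD2 hne
    have hne' : (Subtype.val ⁻¹' C : Set {v : V | v ≠ y}) ≠ Subtype.val ⁻¹' D := by
      intro he
      refine hne (h.eq_of_trace_eq hy ha hb hab hay hby hC hD hC1 hC2 hD1 hD2 fun v hv => ?_)
      exact Set.ext_iff.1 he ⟨v, hv⟩
    rcases hT' _ (hmem C hC hC1 hC2) _ (hmem D hD hD1 hD2) hne' with ⟨q, hq, hqn⟩ | ⟨q, hq, hqn⟩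
    · exact .inl ⟨q, Finset.mem_map_of_mem _ hq, hqn⟩
    · exact .inr ⟨q, Finset.mem_map_of_mem _ hq, hqn⟩
  obtain ⟨n, hn⟩ := hN
  have hne1 : ∀ s ∈ S, s ≠ y → ({s} : Set V) ≠ {y} ∧ ({s} : Set V) ≠ insert y N ∧
      insert s N ≠ {y} ∧ insert s N ≠ insert y N := by
    intro s hs hsy
    have key : ¬ (y ∈ insert s N ∨ y ∈ ({s} : Set V)) := by
      rintro ((h1 | h1) | h1)
      · exact hsy h1.symm
      · exact hd hy h1
      · exact hsy h1.symm
    refine ⟨fun he => ?_, fun he => ?_, fun he => ?_, fun he => ?_⟩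
    · exact key (.inr (he ▸ rfl))
    · exact key (.inr (he ▸ Set.mem_insert _ _))
    · exact key (.inl (he ▸ rfl))
    · exact key (.inl (he ▸ Set.mem_insert _ _))
  have hns : ∀ s ∈ S, n ≠ s := fun s hs he => hd hs (he ▸ hn)
  have hex : ∃ s ∈ S, s ≠ y ∧ s ∈ U (insert s N) := by
    obtain ⟨ha1, ha2, ha3, ha4⟩ := hne1 a ha hay
    obtain ⟨hb1, hb2, hb3, hb4⟩ := hne1 b hb hby
    have hABne : insert a N ≠ insert b N := by
      intro he
      have : a ∈ insert b N := he ▸ Set.mem_insert _ _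
      rcases this with h1 | h1
      · exact hab h1
      · exact hd ha h1
    rcases hU _ (h.insert_mem a ha) ha3 ha4 _ (h.insert_mem b hb) hb3 hb4 hABne with
      ⟨q, hq, hqn⟩ | ⟨q, hq, hqn⟩
    · rcases hUsub _ (h.insert_mem a ha) ha3 ha4 q hq with rfl | hqN
      · exact ⟨q, ha, hay, hq⟩
      · exact absurd (Or.inr hqN) hqn
    · rcases hUsub _ (h.insert_mem b hb) hb3 hb4 q hq with rfl | hqN
      · exact ⟨q, hb, hby, hq⟩
      · exact absurd (Or.inr hqN) hqn
  obtain ⟨s, hs, hsy, hsU⟩ := hex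
  obtain ⟨hs1, hs2, hs3, hs4⟩ := hne1 s hs hsy
  have hUs := hUsub _ (h.insert_mem s hs) hs3 hs4
  let W : Finset V := insert y ((U (insert s N)).erase s)
  have hyn : insert y N ≠ {y} := fun he =>
    hns y hy (he ▸ Set.mem_insert_of_mem _ hn : n ∈ ({y} : Set V))
  let T : Set V → Finset V := fun C => if C = {y} then {y} else if C = insert y N then W else U C
  have hTy : T {y} = {y} := if_pos rfl
  have hTW : T (insert y N) = W := by simp only [T, if_neg hyn, if_true]
  have hTU : ∀ C, C ≠ {y} → C ≠ insert y N → T C = U C := by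
    intro C h1 h2
    simp only [T, if_neg h1, if_neg h2]
  have hWsub : ∀ q ∈ W, q ∈ insert y N := by
    intro q hq
    rcases Finset.mem_insert.1 hq with rfl | hq
    · exact .inl rfl
    · obtain ⟨hqs, hq⟩ := Finset.mem_erase.1 hq
      exact .inr ((hUs q hq).resolve_left hqs)
  have hWN : ∀ q ∈ U (insert s N), q ≠ s → q ∈ W := fun q hq hqs =>
    Finset.mem_insert_of_mem (Finset.mem_erase.2 ⟨hqs, hq⟩)
  have hUne : ∀ C ∈ 𝒞, C ≠ {y} → C ≠ insert y N → C ≠ {s} → s ∈ C → ∃ q ∈ U C, q ≠ s := by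
    intro C hC h1 h2 h3 hsC
    rcases hU C hC h1 h2 _ (h.singleton_mem s hs) hs1 hs2 h3 with ⟨q, hq, hqn⟩ | ⟨q, hq, hqn⟩
    · exact ⟨q, hq, hqn⟩
    · obtain rfl : q = s := hUsub _ (h.singleton_mem s hs) hs1 hs2 q hq
      exact absurd hsC hqn
  have hWU : ∀ C ∈ 𝒞, C ≠ {y} → C ≠ insert y N →
      (∃ q ∈ W, q ∉ C) ∨ ∃ q ∈ U C, q ∉ insert y N := by
    intro C hC h1 h2
    by_cases hyC : y ∈ C
    · have hSC := h.subset_of_ne hC hy hyC h1 h2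
      have hne : insert s N ≠ C := by
        intro he
        rcases (he ▸ hyC : y ∈ insert s N) with h3 | h3
        · exact hsy h3.symm
        · exact hd hy h3
      rcases hU _ (h.insert_mem s hs) hs3 hs4 C hC h1 h2 hne with ⟨q, hq, hqn⟩ | ⟨q, hq, hqn⟩
      · refine .inl ⟨q, hWN q hq ?_, hqn⟩
        rintro rfl
        exact hqn (hSC hs)
      · refine .inr ⟨q, hq, ?_⟩
        rintro (rfl | h3)
        · exact hUy C hq
        · exact hqn (.inr h3)
    · exact .inl ⟨y, Finset.mem_insert_self _ _, hyC⟩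
  have hyU : ∀ C ∈ 𝒞, C ≠ {y} → C ≠ insert y N →
      (∃ q ∈ ({y} : Finset V), q ∉ C) ∨ ∃ q ∈ U C, q ∉ ({y} : Set V) := by
    intro C hC h1 h2
    by_cases hyC : y ∈ C
    · have hSC := h.subset_of_ne hC hy hyC h1 h2
      obtain ⟨q, hq, -⟩ := hUne C hC h1 h2
        (fun he => hsy (he ▸ hyC : y ∈ ({s} : Set V)).symm) (hSC hs)
      refine .inr ⟨q, hq, ?_⟩
      rintro rfl
      exact hUy C hq
    · exact .inl ⟨y, Finset.mem_singleton_self _, hyC⟩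
  have hyW : ∃ q ∈ W, q ∉ ({y} : Set V) := by
    obtain ⟨q, hq, hqs⟩ := hUne _ (h.insert_mem s hs) hs3 hs4
      (fun he => hns s hs (he ▸ Set.mem_insert_of_mem _ hn : n ∈ ({s} : Set V))) (.inl rfl)
    refine ⟨q, hWN q hq hqs, ?_⟩
    rintro rfl
    exact hUy _ hq
  refine ⟨T, isPosNCTM_iff.2 ⟨fun C hC => ?_, fun C hC D hD hne => ?_⟩, fun C hC => ?_⟩
  · by_cases h1 : C = {y}
    · rw [h1, hTy]
      intro q hq
      exact Finset.mem_singleton.1 hq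
    by_cases h2 : C = insert y N
    · rw [h2, hTW]
      exact hWsub
    rw [hTU C h1 h2]
    exact hUsub C hC h1 h2
  · by_cases hC1 : C = {y}
    · rw [hC1, hTy]
      by_cases hD2 : D = insert y N
      · rw [hD2, hTW]
        exact .inr hyW
      have hD1 : D ≠ {y} := fun he => hne (hC1.trans he.symm)
      rw [hTU D hD1 hD2]
      exact hyU D hD hD1 hD2
    by_cases hC2 : C = insert y N
    · rw [hC2, hTW]
      by_cases hD1 : D = {y}
      · rw [hD1]
        exact .inl hyW
      have hD2 : D ≠ insert y N := fun he => hne (hC2.trans he.symm)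
      rw [hTU D hD1 hD2]
      exact hWU D hD hD1 hD2
    rw [hTU C hC1 hC2]
    by_cases hD1 : D = {y}
    · rw [hD1, hTy]
      exact (hyU C hC hC1 hC2).symm
    by_cases hD2 : D = insert y N
    · rw [hD2, hTW]
      exact (hWU C hC hC1 hC2).symm
    rw [hTU D hD1 hD2]
    exact hU C hC hC1 hC2 D hD hD1 hD2 hne
  · by_cases h1 : C = {y}
    · rw [h1, hTy, Finset.card_singleton]
      exact hk
    by_cases h2 : C = insert y N
    · rw [h2, hTW]
      calc W.card ≤ ((U (insert s N)).erase s).card + 1 := Finset.card_insert_le _ _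
        _ = (U (insert s N)).card := Finset.card_erase_add_one hsU
        _ ≤ k := hUcard _ (h.insert_mem s hs) hs3 hs4
    rw [hTU C h1 h2]
    exact hUcard C hC h1 h2

/-- A positive non-clashing teaching map that agrees on `N` at two twins `y` and `z` can be
modified so as not to use `y`. -/
theorem exists_restrict [DecidableEq V] (h : IsTwinFamily 𝒞 S N) {y z w : V} (hy : y ∈ S)
    (hz : z ∈ S) (hw : w ∈ S) (hzy : z ≠ y) (hwy : w ≠ y) (hzw : z ≠ w)
    {k : ℕ} {T : Set V → Finset V} (hT : IsPosNCTM 𝒞 T) (hcard : ∀ C ∈ 𝒞, (T C).card ≤ k)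
    (hyz : ∀ n ∈ N, n ∈ T (insert y N) → n ∈ T (insert z N)) :
    ∃ T' : Set {v : V | v ≠ y} → Finset {v : V | v ≠ y},
      IsPosNCTM (traceFamily 𝒞 N y) T' ∧ ∀ D ∈ traceFamily 𝒞 N y, (T' D).card ≤ k := by
  classical
  have hd := Set.disjoint_left.1 h.disjoint
  rw [isPosNCTM_iff] at hT
  obtain ⟨hsub, hT⟩ := hT
  let f : Finset V → Finset V := fun F =>
    if 2 ≤ (F.filter (· ∈ S)).card then F.filter (· ∉ S) ∪ {z, w}
    else if y ∈ F then insert z (F.erase y) else F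
  have hfcard : ∀ F, (f F).card ≤ F.card := by
    intro F
    dsimp only [f]
    split_ifs with h1 h2
    · have h3 := Finset.card_filter_add_card_filter_not (s := F) (· ∈ S)
      have h4 : (F.filter (· ∉ S) ∪ {z, w}).card ≤
          (F.filter (· ∉ S)).card + ({z, w} : Finset V).card :=
        Finset.card_union_le _ _
      have h5 : ({z, w} : Finset V).card ≤ 2 := Finset.card_le_two
      omega
    · exact (Finset.card_insert_le _ _).trans (Finset.card_erase_add_one h2).le
    · exact le_rfl
  have hfS : ∀ F, ∀ q ∈ F, q ∉ S → q ∈ f F := by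
    intro F q hq hqS
    dsimp only [f]
    split_ifs with h1 h2
    · exact Finset.mem_union_left _ (Finset.mem_filter.2 ⟨hq, hqS⟩)
    · refine Finset.mem_insert_of_mem (Finset.mem_erase.2 ⟨?_, hq⟩)
      rintro rfl
      exact hqS hy
    · exact hq
  have htwo : ∀ F : Finset V, 2 ≤ (F.filter (· ∈ S)).card →
      ∃ p ∈ F, ∃ q ∈ F, p ∈ S ∧ q ∈ S ∧ p ≠ q := by
    intro F hF
    obtain ⟨p, hp, q, hq, hpq⟩ := Finset.one_lt_card.1 hF
    rw [Finset.mem_filter] at hp hq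
    exact ⟨p, hp.1, q, hq.1, hp.2, hq.2, hpq⟩
  have hfull : ∀ C ∈ 𝒞, 2 ≤ ((T C).filter (· ∈ S)).card → S ⊆ C := by
    intro C hC h1
    obtain ⟨p, hp, q, hq, hpS, hqS, hpq⟩ := htwo _ h1
    exact h.subset_of_mem hC hpS hqS hpq (hsub C hC p hp) (hsub C hC q hq)
  have hfy : ∀ F, y ∉ f F := by
    intro F
    dsimp only [f]
    split_ifs with h1 h2
    · simp [hy, hzy.symm, hwy.symm]
    · simp [hzy.symm]
    · exact h2
  have hfsub : ∀ C ∈ 𝒞, C ≠ {y} → C ≠ insert y N → ∀ q ∈ f (T C), q ∈ C := by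
    intro C hC hC1 hC2 q hq
    dsimp only [f] at hq
    split_ifs at hq with h1 h2
    · have hSC := hfull C hC h1
      simp only [Finset.mem_union, Finset.mem_filter, Finset.mem_insert,
        Finset.mem_singleton] at hq
      rcases hq with hq | rfl | rfl
      · exact hsub C hC q hq.1
      · exact hSC hz
      · exact hSC hw
    · have hSC := h.subset_of_ne hC hy (hsub C hC y h2) hC1 hC2
      rcases Finset.mem_insert.1 hq with rfl | hq
      · exact hSC hz
      · exact hsub C hC q (Finset.mem_of_mem_erase hq)
    · exact hsub C hC q hq
  have key : ∀ C ∈ 𝒞, C ≠ {y} → C ≠ insert y N → ∀ D ∈ 𝒞, D ≠ {y} → D ≠ insert y N →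
      (∃ q ∈ T C, q ∉ D) → (∃ q ∈ f (T C), q ∉ D) ∨ ∃ q ∈ f (T D), q ∉ C := by
    rintro C hC hC1 hC2 D hD hD1 hD2 ⟨q, hq, hqD⟩
    by_cases hqS : q ∉ S
    · exact .inl ⟨q, hfS _ q hq hqS, hqD⟩
    rw [not_not] at hqS
    by_cases h1 : 2 ≤ ((T C).filter (· ∈ S)).card
    · have hfC : f (T C) = (T C).filter (· ∉ S) ∪ {z, w} := if_pos h1
      by_cases hzD : z ∈ D
      · have hwD : w ∉ D := fun hwD => hqD (h.subset_of_mem hD hz hw hzw hzD hwD hqS)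
        exact .inl ⟨w, by simp [hfC], hwD⟩
      · exact .inl ⟨z, by simp [hfC], hzD⟩
    by_cases hyC : y ∈ T C
    swap
    · have hfC : f (T C) = T C := by simp only [f, if_neg h1, if_neg hyC]
      exact .inl ⟨q, hfC.symm ▸ hq, hqD⟩
    have hfC : f (T C) = insert z ((T C).erase y) := by simp only [f, if_neg h1, if_pos hyC]
    have huniq : ∀ p ∈ T C, p ∈ S → p = y := by
      intro p hp hpS
      by_contra hpy
      exact h1 (Finset.one_lt_card.2 ⟨p, Finset.mem_filter.2 ⟨hp, hpS⟩, y,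
        Finset.mem_filter.2 ⟨hyC, hy⟩, hpy⟩)
    have hSC := h.subset_of_ne hC hy (hsub C hC y hyC) hC1 hC2
    by_cases hzD : z ∉ D
    · exact .inl ⟨z, by simp [hfC], hzD⟩
    rw [not_not] at hzD
    by_cases hDz : D = {z}
    · rcases hT C hC _ (h.singleton_mem y hy) hC1 with ⟨p, hp, hpy⟩ | ⟨p, hp, hpC⟩
      · refine .inl ⟨p, ?_, ?_⟩
        · rw [hfC]
          exact Finset.mem_insert_of_mem (Finset.mem_erase.2 ⟨hpy, hp⟩)
        · rw [hDz]
          rintro rfl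
          exact hzy (huniq _ hp hz)
      · obtain rfl : p = y := hsub _ (h.singleton_mem y hy) p hp
        exact absurd (hSC hy) hpC
    by_cases hDN : D = insert z N
    · rcases hT C hC _ (h.insert_mem y hy) hC2 with ⟨p, hp, hpy⟩ | ⟨p, hp, hpC⟩
      · have hpS : p ∉ S := fun hpS => hpy (.inl (huniq p hp hpS))
        refine .inl ⟨p, hfS _ p hp hpS, ?_⟩
        rw [hDN]
        rintro (rfl | hpN)
        · exact hpS hz
        · exact hpy (.inr hpN)
      · rcases hsub _ (h.insert_mem y hy) p hp with rfl | hpN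
        · exact absurd (hSC hy) hpC
        · refine .inr ⟨p, hfS _ p ?_ fun hpS => hd hpS hpN, hpC⟩
          rw [hDN]
          exact hyz p hpN hp
    · exact absurd (h.subset_of_ne hD hz hzD hDz hDN hqS) hqD
  have hchoose : ∀ D : Set {v : V | v ≠ y}, ∃ C : Set V, D ∈ traceFamily 𝒞 N y →
      C ∈ 𝒞 ∧ C ≠ {y} ∧ C ≠ insert y N ∧ D = Subtype.val ⁻¹' C := by
    intro D
    by_cases hD : D ∈ traceFamily 𝒞 N y
    · exact hD.imp fun C hC _ => hC
    · exact ⟨∅, fun h1 => absurd h1 hD⟩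
  choose E hE using hchoose
  have hmemT : ∀ D (q : {v : V | v ≠ y}),
      q ∈ (f (T (E D))).subtype (· ∈ {v : V | v ≠ y}) ↔ q.1 ∈ f (T (E D)) :=
    fun D q => Finset.mem_subtype
  refine ⟨fun D => (f (T (E D))).subtype (· ∈ {v : V | v ≠ y}),
    isPosNCTM_iff.2 ⟨fun D hD q hq => ?_, fun D hD D' hD' hne => ?_⟩, fun D hD => ?_⟩
  · obtain ⟨h1, h2, h3, h4⟩ := hE D hD
    rw [h4]
    exact hfsub _ h1 h2 h3 _ ((hmemT _ _).1 hq)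
  · obtain ⟨h1, h2, h3, h4⟩ := hE D hD
    obtain ⟨h1', h2', h3', h4'⟩ := hE D' hD'
    have hne' : E D ≠ E D' := by
      intro he
      rw [h4, h4', he] at hne
      exact hne rfl
    have hlift : (∃ q ∈ f (T (E D)), q ∉ E D') ∨ ∃ q ∈ f (T (E D')), q ∉ E D := by
      rcases hT _ h1 _ h1' hne' with h5 | h5
      · exact key _ h1 h2 h3 _ h1' h2' h3' h5
      · exact (key _ h1' h2' h3' _ h1 h2 h3 h5).symm
    have hpush : ∀ {D D' : Set {v : V | v ≠ y}}, D' = Subtype.val ⁻¹' E D' →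
        (∃ q ∈ f (T (E D)), q ∉ E D') →
        ∃ q ∈ (f (T (E D))).subtype (· ∈ {v : V | v ≠ y}), q ∉ D' := by
      rintro D D' hD' ⟨q, hq, hqn⟩
      refine ⟨⟨q, fun he => hfy _ (he ▸ hq)⟩, (hmemT _ _).2 hq, ?_⟩
      rw [hD']
      exact hqn
    exact hlift.imp (hpush h4') (hpush h4)
  · have h1 := hcard _ (hE D hD).1
    rw [Finset.card_subtype]
    exact ((Finset.card_filter_le _ _).trans (hfcard _)).trans h1

/-- If there are more twins than subsets of `N`, then a positive non-clashing teaching map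
can be restricted. -/
theorem exists_restrict_of_card [DecidableEq V] {𝒞 : Set (Set V)} {N : Set V} {S X : Finset V}
    (h : IsTwinFamily 𝒞 (S : Set V) N) (hNX : N ⊆ X) (hX : 2 ^ X.card < S.card) (hS : 3 ≤ S.card)
    {y : V} (hy : y ∈ S) {k : ℕ} {T : Set V → Finset V} (hT : IsPosNCTM 𝒞 T)
    (hcard : ∀ C ∈ 𝒞, (T C).card ≤ k) :
    ∃ T' : Set {v : V | v ≠ y} → Finset {v : V | v ≠ y},
      IsPosNCTM (traceFamily 𝒞 N y) T' ∧ ∀ D ∈ traceFamily 𝒞 N y, (T' D).card ≤ k := by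
  obtain ⟨a, ha, b, hb, hab, heq⟩ := Finset.exists_ne_map_eq_of_card_lt_of_maps_to
    (s := S) (t := X.powerset) (f := fun s => T (insert s N) ∩ X)
    (by rwa [Finset.card_powerset]) (fun s _ => Finset.mem_powerset.2 Finset.inter_subset_right)
  have hd := Set.disjoint_left.1 h.disjoint
  let σ := Equiv.swap y a
  have hσS : ∀ s ∈ S, σ s ∈ S := by
    intro s hs
    rw [Equiv.swap_apply_def]
    split_ifs <;> assumption
  have hσN : ∀ n ∈ N, σ n = n := fun n hn =>
    Equiv.swap_apply_of_ne_of_ne (fun he => hd hy (he ▸ hn)) (fun he => hd ha (he ▸ hn))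
  have hσpre : ∀ s, σ ⁻¹' insert (σ s) N = insert s N := by
    intro s
    ext v
    simp only [Set.mem_preimage, Set.mem_insert_iff, EmbeddingLike.apply_eq_iff_eq]
    refine or_congr_right ⟨fun hv => ?_, fun hv => (hσN v hv).symm ▸ hv⟩
    have h1 : σ (σ v) = σ v := hσN _ hv
    rwa [σ.injective h1] at hv
  have hσb : σ b ≠ y := by
    intro he
    exact hab (σ.injective ((Equiv.swap_apply_right y a).trans he.symm))
  obtain ⟨w, hw⟩ : ((S.erase y).erase (σ b)).Nonempty := by
    rw [← Finset.card_pos, Finset.card_erase_of_mem (Finset.mem_erase.2 ⟨hσb, hσS b hb⟩),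
      Finset.card_erase_of_mem hy]
    omega
  simp only [Finset.mem_erase] at hw
  obtain ⟨hwb, hwy, hwS⟩ := hw
  refine h.exists_restrict (z := σ b) (w := w) hy (hσS b hb) hwS hσb hwy hwb.symm
    (h.swap_teaching hy ha hT) (k := k) (fun C hC => ?_) fun n hn hnT => ?_
  · rw [Finset.card_map]
    exact hcard _ (h.preimage_swap_mem hy ha hC)
  · have hya : y = σ a := (Equiv.swap_apply_right y a).symm
    have hmem : ∀ s, n ∈ (T (σ ⁻¹' insert (σ s) N)).map σ.toEmbedding ↔ n ∈ T (insert s N) := by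
      intro s
      rw [hσpre]
      conv_lhs => rw [← hσN n hn]
      exact Finset.mem_map' _
    refine (hmem b).2 ?_
    have h1 : n ∈ T (insert a N) := (hmem a).1 (by rwa [← hya])
    have h2 : n ∈ T (insert a N) ∩ X := Finset.mem_inter.2 ⟨h1, hNX hn⟩
    have h3 : n ∈ T (insert b N) ∩ X := heq ▸ h2
    exact (Finset.mem_inter.1 h3).1

end IsTwinFamily

namespace SimpleGraph

variable {V : Type*} {G : SimpleGraph V}

theorem Connected.dist_hom_le {W : Type*} {H : SimpleGraph W} (hG : G.Connected) (f : G →g H)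
    (a b : V) : H.dist (f a) (f b) ≤ G.dist a b := by
  obtain ⟨p, hp⟩ := hG.exists_walk_length_eq_dist a b
  rw [← hp, ← p.length_map f]
  exact dist_le _

theorem Connected.dist_le_dist_of_twins (hG : G.Connected) {s t x : V}
    (h : G.neighborSet s = G.neighborSet t) (hx : x ≠ s) : G.dist x t ≤ G.dist x s := by
  obtain ⟨p, hp⟩ := hG.exists_walk_length_eq_dist s x
  cases p with
  | nil => exact absurd rfl hx
  | cons hadj p =>
    have hadj' : G.Adj t _ := (Set.ext_iff.1 h _).1 hadj
    rw [dist_comm, dist_comm (u := x), ← hp]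
    exact dist_le (Walk.cons hadj' p)

theorem Connected.dist_le_two_of_twins (hG : G.Connected) [Nontrivial V] {s t : V}
    (h : G.neighborSet s = G.neighborSet t) : G.dist s t ≤ 2 := by
  obtain ⟨u, hu⟩ := hG.preconnected.exists_adj_of_nontrivial s
  have hu' : G.Adj t u := (Set.ext_iff.1 h u).1 hu
  exact dist_le (Walk.cons hu (Walk.cons hu'.symm Walk.nil))

theorem gball_zero (hG : G.Connected) (x : V) : gball G x 0 = {x} := by
  ext v
  simp [gball, hG.dist_eq_zero_iff, eq_comm]

theorem gball_one (hG : G.Connected) (x : V) : gball G x 1 = insert x (G.neighborSet x) := by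
  ext v
  rw [gball, Set.mem_ofPred_eq, Set.mem_insert_iff, mem_neighborSet,
    Nat.le_one_iff_eq_zero_or_eq_one, hG.dist_eq_zero_iff, dist_eq_one_iff_adj, eq_comm]

theorem isTwinFamily_gballs [Nontrivial V] (hG : G.Connected) {S N : Set V}
    (hS : ∀ s ∈ S, G.neighborSet s = N) : IsTwinFamily (gballs G) S N where
  cases := by
    rintro _ ⟨x, r, rfl⟩
    by_cases hx : x ∈ S
    · match r with
      | 0 => exact .inr (.inr ⟨x, hx, .inl (gball_zero hG x)⟩)
      | 1 => exact .inr (.inr ⟨x, hx, .inr (by rw [gball_one hG, hS x hx])⟩)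
      | r + 2 =>
        refine .inl fun s hs => ?_
        have := hG.dist_le_two_of_twins ((hS x hx).trans (hS s hs).symm)
        exact this.trans (by omega)
    · have key : ∀ s ∈ S, ∀ t ∈ S, G.dist x t ≤ G.dist x s := fun s hs t ht =>
        hG.dist_le_dist_of_twins ((hS s hs).trans (hS t ht).symm) (fun he => hx (he ▸ hs))
      by_cases h : ∃ s ∈ S, s ∈ gball G x r
      · obtain ⟨s, hs, hsr⟩ := h
        exact .inl fun t ht => (key s hs t ht).trans hsr
      · exact .inr (.inl (Set.disjoint_left.2 fun s hs hsr => h ⟨s, hs, hsr⟩))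
  singleton_mem s _ := ⟨s, 0, (gball_zero hG s).symm⟩
  insert_mem s hs := ⟨s, 1, by rw [gball_one hG, hS s hs]⟩
  disjoint := by
    refine Set.disjoint_left.2 fun s hs hsN => ?_
    rw [← hS s hs] at hsN
    exact G.irrefl hsN

theorem gball_eq_of_twins [Nontrivial V] (hG : G.Connected) {s t : V}
    (h : G.neighborSet s = G.neighborSet t) {r : ℕ} (hr : 2 ≤ r) : gball G s r = gball G t r := by
  have key : ∀ {s t : V}, G.neighborSet s = G.neighborSet t → gball G s r ⊆ gball G t r := by
    intro s t h v hv
    by_cases hvs : v = s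
    · rw [hvs]
      exact (hG.dist_le_two_of_twins h.symm).trans hr
    · have h1 := hG.dist_le_dist_of_twins h hvs
      rw [dist_comm, dist_comm (u := v)] at h1
      exact h1.trans hv
  exact (key h).antisymm (key h.symm)

/-- The retraction of a graph onto the complement of a vertex `y` sending `y` to a false twin. -/
def twinRetraction [DecidableEq V] {y z : V} (hzy : z ≠ y)
    (h : G.neighborSet y = G.neighborSet z) : G →g G.induce {v : V | v ≠ y} where
  toFun v := if hv : v = y then ⟨z, hzy⟩ else ⟨v, hv⟩
  map_rel' := by
    intro a b hab
    have h' : ∀ v, G.Adj y v ↔ G.Adj z v := fun v => Set.ext_iff.1 h v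
    by_cases ha : a = y <;> by_cases hb : b = y
    · exact absurd (ha.trans hb.symm) hab.ne
    · simp only [ha, hb, dite_true, dite_false, comap_adj, Function.Embedding.subtype_apply]
      exact (h' b).1 (ha ▸ hab)
    · simp only [ha, hb, dite_true, dite_false, comap_adj, Function.Embedding.subtype_apply]
      exact ((h' a).1 (hb ▸ hab.symm)).symm
    · simpa only [ha, hb, dite_false, comap_adj, Function.Embedding.subtype_apply] using hab

theorem twinRetraction_apply [DecidableEq V] {y z : V} (hzy : z ≠ y)
    (h : G.neighborSet y = G.neighborSet z) (v : {v : V | v ≠ y}) :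
    twinRetraction hzy h v.1 = v :=
  dif_neg v.2

theorem Connected.induce_ne_of_twin [DecidableEq V] (hG : G.Connected) {y z : V} (hzy : z ≠ y)
    (h : G.neighborSet y = G.neighborSet z) : (G.induce {v : V | v ≠ y}).Connected where
  preconnected a b := by
    have h1 := (hG.preconnected a.1 b.1).map (twinRetraction hzy h)
    rwa [twinRetraction_apply, twinRetraction_apply] at h1
  nonempty := ⟨⟨z, hzy⟩⟩

theorem gball_induce_ne [DecidableEq V] (hG : G.Connected) {y z : V} (hzy : z ≠ y)
    (h : G.neighborSet y = G.neighborSet z) (x : {v : V | v ≠ y}) (r : ℕ) :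
    gball (G.induce {v : V | v ≠ y}) x r = Subtype.val ⁻¹' gball G x.1 r := by
  ext v
  have h1 := hG.dist_hom_le (twinRetraction hzy h) x.1 v.1
  rw [twinRetraction_apply, twinRetraction_apply] at h1
  have h2 := (hG.induce_ne_of_twin hzy h).dist_hom_le
    (SimpleGraph.Embedding.induce {v : V | v ≠ y}).toHom x v
  exact ⟨fun h3 => h2.trans h3, fun h3 => h1.trans h3⟩

theorem gballs_induce_ne [DecidableEq V] [Nontrivial V] (hG : G.Connected) {S N : Set V}
    (hS : ∀ s ∈ S, G.neighborSet s = N) {y z : V} (hy : y ∈ S) (hz : z ∈ S) (hzy : z ≠ y) :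
    gballs (G.induce {v : V | v ≠ y}) = traceFamily (gballs G) N y := by
  have hyz : G.neighborSet y = G.neighborSet z := (hS y hy).trans (hS z hz).symm
  ext D
  constructor
  · rintro ⟨x, r, rfl⟩
    refine ⟨gball G x.1 r, ⟨x.1, r, rfl⟩, fun he => ?_, fun he => ?_,
      gball_induce_ne hG hzy hyz x r⟩
    · have hx : x.1 ∈ gball G x.1 r := by simp [gball]
      rw [he] at hx
      exact x.2 hx
    · have hzN : z ∉ insert y N := by
        rintro (h1 | h1)
        · exact hzy h1
        · rw [← hS z hz] at h1
          exact G.irrefl h1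
      have hyN : y ∈ insert y N := .inl rfl
      rw [← he] at hzN hyN
      exact hzN ((hG.dist_le_dist_of_twins hyz x.2).trans hyN)
  · rintro ⟨_, ⟨x, r, rfl⟩, h1, h2, rfl⟩
    by_cases hx : x = y
    · subst hx
      match r with
      | 0 => exact absurd (gball_zero hG x) h1
      | 1 => exact absurd (by rw [gball_one hG, hS x hy]) h2
      | r + 2 =>
        refine ⟨⟨z, hzy⟩, r + 2, ?_⟩
        rw [gball_induce_ne hG hzy hyz, gball_eq_of_twins hG hyz (by omega)]
    · exact ⟨⟨x, hx⟩, r, (gball_induce_ne hG hzy hyz ⟨x, hx⟩ r).symm⟩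

end SimpleGraph

/-- Reduction-rule safety. Let `G` be a finite connected graph on at least `3`
vertices, `X` a vertex cover of `G`, and `S` a set of at least `2^{|X|} + 2` vertices
outside `X` that are pairwise false twins. For `y ∈ S`, the induced subgraph `G'` of
`G` on `V(G) \ {y}` is connected, and for every positive integer `k`, `B(G)` admits
a positive non-clashing teaching map of size at most `k` if and only if `B(G')`
does. -/
theorem stmt19 {V : Type*} [Fintype V] [DecidableEq V] (G : SimpleGraph V)
    (hconn : G.Connected) (hcard : 3 ≤ Fintype.card V)
    (X S : Finset V)
    (hX : ∀ a b : V, G.Adj a b → a ∈ X ∨ b ∈ X)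
    (hSX : ∀ v ∈ S, v ∉ X)
    (hScard : 2 ^ X.card + 2 ≤ S.card)
    (htwins : ∀ a ∈ S, ∀ b ∈ S, G.neighborSet a = G.neighborSet b)
    (y : V) (hy : y ∈ S) :
    (G.induce {v : V | v ≠ y}).Connected ∧
    ∀ k : ℕ, 0 < k →
      ((∃ T : Set V → Finset V,
          IsPosNCTM (gballs G) T ∧ ∀ C ∈ gballs G, (T C).card ≤ k) ↔
       (∃ T' : Set {v : V | v ≠ y} → Finset {v : V | v ≠ y},
          IsPosNCTM (gballs (G.induce {v : V | v ≠ y})) T' ∧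
          ∀ C ∈ gballs (G.induce {v : V | v ≠ y}), (T' C).card ≤ k)) := by
  have hSpos : 0 < 2 ^ X.card := by positivity
  have : Nontrivial V := Fintype.one_lt_card_iff_nontrivial.1 (by omega)
  set N := G.neighborSet y with hN
  have hSN : ∀ s ∈ (S : Set V), G.neighborSet s = N := fun s hs => htwins s hs y hy
  have hNX : N ⊆ X := fun v hv => (hX y v hv).resolve_left (hSX y hy)
  obtain ⟨n, hn⟩ : N.Nonempty := hconn.preconnected.exists_adj_of_nontrivial y
  have hS3 : 3 ≤ S.card := by omega
  obtain ⟨a, ha, b, hb, hab⟩ := Finset.one_lt_card.1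
    (show 1 < (S.erase y).card by rw [Finset.card_erase_of_mem hy]; omega)
  rw [Finset.mem_erase] at ha hb
  have htwin := isTwinFamily_gballs hconn hSN
  refine ⟨hconn.induce_ne_of_twin ha.1 (hSN a ha.2).symm, fun k hk => ?_⟩
  rw [gballs_induce_ne hconn hSN hy ha.2 ha.1]
  constructor
  · rintro ⟨T, hT, hcardT⟩
    exact htwin.exists_restrict_of_card hNX (by omega) hS3 hy hT hcardT
  · rintro ⟨T', hT', hcardT'⟩
    exact htwin.exists_extend hy ha.2 hb.2 hab ha.1 hb.1 ⟨n, hn⟩ hk hT' hcardT'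
end
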